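/- There exists a constant C > 0 depending only on m with the following property. If f is both squeeze stationary and squash stationary, a ∈ U, r₀ > 0 and B(a, 3r₀) ⊂ U, then sup_{x ∈ B(a,r₀)} ‖f(x)‖² ≤ (C/r₀^m)·∫_{B(a,3r₀)} ‖f‖². -/

import Mathlib

open MeasureTheory Metric
open scoped RealInnerProductSpace ENNReal NNReal Topology
noncomputable section

/-- The separable Hilbert space `ℓ₂` of square-summable real sequences. -/
abbrev ell2 : Type := lp (fun _ : ℕ => ℝ) 2

/-- Euclidean space `ℝ^m`. -/
abbrev Em (m : ℕ) : Type := EuclideanSpace ℝ (Fin m)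

/-- Squared Hilbert–Schmidt norm `‖A‖²_HS = ∑ i ‖A eᵢ‖²` of `A : ℝ^m →L ℓ₂`. -/
def hsNormSq {m : ℕ} (A : Em m →L[ℝ] ell2) : ℝ :=
  ∑ i : Fin m, ‖A (EuclideanSpace.single i 1)‖ ^ 2

/-- Hilbert–Schmidt inner product `⟨A,B⟩ = ∑ i ⟨A eᵢ, B eᵢ⟩`. -/
def hsInner {m : ℕ} (A B : Em m →L[ℝ] ell2) : ℝ :=
  ∑ i : Fin m, ⟪A (EuclideanSpace.single i 1), B (EuclideanSpace.single i 1)⟫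

/-- Divergence `div X = ∑ i ⟨DX(x) eᵢ, eᵢ⟩` of a vector field `X : ℝ^m → ℝ^m`. -/
def divg {m : ℕ} (X : Em m → Em m) (x : Em m) : ℝ :=
  ∑ i : Fin m, ⟪fderiv ℝ X x (EuclideanSpace.single i 1), EuclideanSpace.single i 1⟫

/-- `f` is squeeze stationary on `U`: for every smooth compactly supported vector field
`X` with support in `U`, the inner variation `t ↦ ∫_U ‖D(f ∘ Φ_t)‖²_HS`,
`Φ_t(x) = x + tX(x)`, has derivative `0` at `t = 0`. -/
def SqueezeStationary {m : ℕ} (U : Set (Em m)) (f : Em m → ell2) : Prop :=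
  ∀ X : Em m → Em m, ContDiff ℝ (⊤ : ℕ∞) X → HasCompactSupport X → tsupport X ⊆ U →
    HasDerivAt
      (fun t : ℝ => ∫ x in U, hsNormSq (fderiv ℝ (fun y => f (y + t • X y)) x)) 0 0

/-- `f` is squash stationary on `U`: for every `C¹` map `Y : U × ℓ₂ → ℓ₂` which is
bounded, has bounded derivative, and with `{x : Y(x,·) ≢ 0}` relatively compact in `U`,
the outer variation `t ↦ ∫_U ‖D(f + tY(·, f(·)))‖²_HS` has derivative `0` at `t = 0`. -/
def SquashStationary {m : ℕ} (U : Set (Em m)) (f : Em m → ell2) : Prop :=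
  ∀ Y : Em m × ell2 → ell2, ContDiff ℝ 1 Y →
    (∃ C, ∀ p, ‖Y p‖ ≤ C) → (∃ C, ∀ p, ‖fderiv ℝ Y p‖ ≤ C) →
    IsCompact (closure {x : Em m | ∃ y, Y (x, y) ≠ 0}) →
    closure {x : Em m | ∃ y, Y (x, y) ≠ 0} ⊆ U →
    HasDerivAt
      (fun t : ℝ =>
        ∫ x in U, hsNormSq (fderiv ℝ (fun z => f z + t • Y (z, f z)) x)) 0 0

theorem hsNormSq_nonneg {m : ℕ} (A : Em m →L[ℝ] ell2) : 0 ≤ hsNormSq A :=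
  Finset.sum_nonneg fun _ _ => sq_nonneg _

theorem hsNormSq_add_smul {m : ℕ} (A B : Em m →L[ℝ] ell2) (t : ℝ) :
    hsNormSq (A + t • B) = hsNormSq A + t * (2 * hsInner A B) + t ^ 2 * hsNormSq B := by
  simp only [hsNormSq, hsInner, Finset.mul_sum, ← Finset.sum_add_distrib]
  refine Finset.sum_congr rfl fun i _ => ?_
  rw [add_apply, smul_apply, norm_add_sq_real,
    inner_smul_right, norm_smul, mul_pow, Real.norm_eq_abs, sq_abs]
  ring

theorem continuous_hsNormSq {m : ℕ} : Continuous (hsNormSq (m := m)) := by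
  unfold hsNormSq
  fun_prop

theorem ContinuousOn.hsInner {m : ℕ} {U : Set (Em m)} {A B : Em m → (Em m →L[ℝ] ell2)}
    (hA : ContinuousOn A U) (hB : ContinuousOn B U) :
    ContinuousOn (fun x => hsInner (A x) (B x)) U := by
  unfold _root_.hsInner
  fun_prop

theorem map_eq_sum_single {m : ℕ} {F : Type*} [AddCommGroup F] [Module ℝ F] [TopologicalSpace F]
    (A : Em m →L[ℝ] F) (w : Em m) :
    A w = ∑ i, w i • A (EuclideanSpace.single i 1) := by
  conv_lhs => rw [← (EuclideanSpace.basisFun (Fin m) ℝ).sum_repr w]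
  simp

theorem sq_norm_apply_le {m : ℕ} (A : Em m →L[ℝ] ell2) (w : Em m) :
    ‖A w‖ ^ 2 ≤ ‖w‖ ^ 2 * hsNormSq A := by
  have h : ‖A w‖ ≤ ∑ i, ‖w i‖ * ‖A (EuclideanSpace.single i 1)‖ := by
    rw [map_eq_sum_single A w]
    refine (norm_sum_le _ _).trans (le_of_eq ?_)
    simp only [norm_smul]
  rw [EuclideanSpace.norm_sq_eq]
  exact (pow_le_pow_left₀ (norm_nonneg _) h 2).trans (Finset.sum_mul_sq_le_sq_mul_sq _ _ _)

/-- Pairing with the rank one map `w ↦ ⟪z, w⟫ v` evaluates at `z`. -/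
theorem hsInner_smulRight_innerSL {m : ℕ} (A : Em m →L[ℝ] ell2) (z : Em m) (v : ell2) :
    hsInner A ((innerSL ℝ z).smulRight v) = ⟪A z, v⟫ := by
  rw [map_eq_sum_single A z, sum_inner, hsInner]
  refine Finset.sum_congr rfl fun i _ => ?_
  rw [ContinuousLinearMap.smulRight_apply, innerSL_apply_apply, inner_smul_left, inner_smul_right,
    EuclideanSpace.inner_single_right]
  simp

theorem hsInner_smul_right {m : ℕ} (A B : Em m →L[ℝ] ell2) (c : ℝ) :
    hsInner A (c • B) = c * hsInner A B := by
  simp [hsInner, inner_smul_right, Finset.mul_sum]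

theorem integrableOn_of_continuousOn_of_eq_zero {m : ℕ} {U K : Set (Em m)} (hU : IsOpen U)
    (hK : IsCompact K) (hKU : K ⊆ U) {g : Em m → ℝ} (hg : ContinuousOn g U)
    (h0 : ∀ x ∉ K, g x = 0) : IntegrableOn g U :=
  ((hg.mono hKU).integrableOn_compact hK).of_forall_sdiff_eq_zero hU.measurableSet
    fun x hx => h0 x hx.2

theorem hasDerivAt_quadratic_zero (a b c : ℝ) :
    HasDerivAt (fun t : ℝ => a + t * b + t ^ 2 * c) b 0 := by
  exact ((((hasDerivAt_id (0 : ℝ)).mul_const b).const_add a).add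
    (((hasDerivAt_id (0 : ℝ)).pow 2).mul_const c)).congr_deriv (by simp)

theorem exists_norm_fderiv_smul_const_le {E F : Type*} [NormedAddCommGroup E] [NormedSpace ℝ E]
    [NormedAddCommGroup F] [NormedSpace ℝ F] {φ : E → ℝ} (hφ : ContDiff ℝ 1 φ)
    (hφc : HasCompactSupport φ) (v : F) :
    ∃ C, ∀ p, ‖fderiv ℝ (fun p : E × F => φ p.1 • v) p‖ ≤ C := by
  obtain ⟨C, hC⟩ :=
    (hφ.continuous_fderiv one_ne_zero).bounded_above_of_compact_support (hφc.fderiv ℝ)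
  refine ⟨C * ‖v‖, fun p => ?_⟩
  have hd : HasFDerivAt (fun p : E × F => φ p.1 • v)
      (((fderiv ℝ φ p.1).comp (ContinuousLinearMap.fst ℝ E F)).smulRight v) p :=
    ((hφ.differentiable one_ne_zero p.1).hasFDerivAt.comp p hasFDerivAt_fst).smul_const v
  rw [hd.fderiv, ContinuousLinearMap.norm_smulRight_apply]
  refine mul_le_mul_of_nonneg_right ?_ (norm_nonneg _)
  refine (ContinuousLinearMap.opNorm_comp_le _ _).trans ?_
  exact (mul_le_of_le_one_right (norm_nonneg _)
    (ContinuousLinearMap.norm_fst_le ..)).trans (hC _)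

/-- First variation of the Dirichlet energy along a family whose derivatives are affine in `t`. -/
theorem integral_hsInner_eq_zero_of_hasDerivAt {m : ℕ} {U K : Set (Em m)} (hU : IsOpen U)
    (hK : IsCompact K) (hKU : K ⊆ U) {f' B : Em m → (Em m →L[ℝ] ell2)}
    (hf' : ContinuousOn f' U) (hE : IntegrableOn (fun x => hsNormSq (f' x)) U volume)
    (hB : Continuous B) (hB0 : ∀ x ∉ K, B x = 0) {G : ℝ → Em m → ell2}
    (hG : ∀ t, ∀ x ∈ U, HasFDerivAt (G t) (f' x + t • B x) x)
    (hd : HasDerivAt (fun t : ℝ => ∫ x in U, hsNormSq (fderiv ℝ (G t) x)) 0 0) :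
    ∫ x in U, hsInner (f' x) (B x) = 0 := by
  have h1 : IntegrableOn (fun x => hsInner (f' x) (B x)) U :=
    integrableOn_of_continuousOn_of_eq_zero hU hK hKU
      (hf'.hsInner hB.continuousOn)
      fun x hx => by simp [hsInner, hB0 x hx]
  have h2 : IntegrableOn (fun x => hsNormSq (B x)) U :=
    integrableOn_of_continuousOn_of_eq_zero hU hK hKU
      (continuous_hsNormSq.comp hB).continuousOn
      fun x hx => by simp [hsNormSq, hB0 x hx]
  have hEq : (fun t : ℝ => ∫ x in U, hsNormSq (fderiv ℝ (G t) x)) =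
      fun t => (∫ x in U, hsNormSq (f' x)) + t * (2 * ∫ x in U, hsInner (f' x) (B x))
        + t ^ 2 * ∫ x in U, hsNormSq (B x) := by
    funext t
    rw [← integral_const_mul, ← integral_const_mul, ← integral_const_mul, ← integral_add hE,
      ← integral_add]
    · refine setIntegral_congr_fun hU.measurableSet fun x hx => ?_
      simp only [(hG t x hx).fderiv, hsNormSq_add_smul]
    · exact hE.add ((h1.const_mul 2).const_mul t)
    · exact h2.const_mul _
    · exact (h1.const_mul 2).const_mul t
  rw [hEq] at hd
  linarith [(hasDerivAt_quadratic_zero (∫ x in U, hsNormSq (f' x))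
    (2 * ∫ x in U, hsInner (f' x) (B x)) (∫ x in U, hsNormSq (B x))).unique hd]

/-- Squash stationary maps are weakly harmonic. -/
theorem SquashStationary.integral_hsInner_eq_zero {m : ℕ} {U : Set (Em m)} (hU : IsOpen U)
    {f : Em m → ell2} {f' : Em m → (Em m →L[ℝ] ell2)}
    (hf : ∀ x ∈ U, HasFDerivAt f (f' x) x) (hf' : ContinuousOn f' U)
    (hE : IntegrableOn (fun x => hsNormSq (f' x)) U volume) (hs : SquashStationary U f)
    {φ : Em m → ℝ} (hφ : ContDiff ℝ 1 φ) (hφc : HasCompactSupport φ) (hφU : tsupport φ ⊆ U)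
    (v : ell2) : ∫ x in U, hsInner (f' x) ((fderiv ℝ φ x).smulRight v) = 0 := by
  have hφ' : Continuous (fderiv ℝ φ) := hφ.continuous_fderiv one_ne_zero
  have hsub : closure {x : Em m | ∃ _ : ell2, φ x • v ≠ 0} ⊆ tsupport φ := by
    refine closure_mono ?_
    rintro x ⟨_, hx⟩
    exact left_ne_zero_of_smul hx
  have hbdd : ∃ C, ∀ p : Em m × ell2, ‖φ p.1 • v‖ ≤ C := by
    obtain ⟨C, hC⟩ := hφ.continuous.bounded_above_of_compact_support hφc
    refine ⟨C * ‖v‖, fun p => ?_⟩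
    rw [norm_smul]
    exact mul_le_mul_of_nonneg_right (hC _) (norm_nonneg _)
  have key := hs (fun p => φ p.1 • v) ((hφ.comp contDiff_fst).smul contDiff_const) hbdd
    (exists_norm_fderiv_smul_const_le hφ hφc v)
    (hφc.of_isClosed_subset isClosed_closure hsub) (hsub.trans hφU)
  refine integral_hsInner_eq_zero_of_hasDerivAt hU hφc hφU hf' hE
    (((ContinuousLinearMap.smulRightL ℝ (Em m) ell2).flip v).continuous.comp hφ') ?_
    (G := fun t z => f z + t • (φ z • v)) ?_ key
  · intro x hx
    have : fderiv ℝ φ x = 0 :=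
      Function.notMem_support.1 fun h => hx (support_fderiv_subset ℝ h)
    ext1 w
    simp [this]
  · intro t x hx
    exact (hf x hx).add
      (((hφ.differentiable one_ne_zero x).hasFDerivAt.smul_const v).const_smul t)

theorem hasDerivAt_sq_max_zero (t : ℝ) :
    HasDerivAt (fun t : ℝ => max 0 t ^ 2) (2 * max 0 t) t := by
  rcases lt_trichotomy t 0 with h | h | h
  · rw [max_eq_left h.le, mul_zero]
    refine (hasDerivAt_const t (0 : ℝ)).congr_of_eventuallyEq ?_
    filter_upwards [Iio_mem_nhds h] with y hy
    simp [max_eq_left hy.out.le]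
  · subst h
    simp only [max_self, mul_zero]
    refine HasDerivAt.of_isLittleO ?_
    have : (fun y : ℝ => max 0 y ^ 2) =O[𝓝 0] fun y => y ^ 2 := by
      refine Asymptotics.IsBigO.of_bound 1 (Filter.Eventually.of_forall fun y => ?_)
      rcases le_total 0 y with hy | hy <;> simp [hy, sq_nonneg]
    simpa using this.trans_isLittleO (Asymptotics.isLittleO_pow_id one_lt_two)
  · rw [max_eq_right h.le]
    refine HasDerivAt.congr_of_eventuallyEq (f := fun y => y ^ 2)
      (by simpa using hasDerivAt_pow 2 t) ?_
    filter_upwards [Ioi_mem_nhds h] with y hy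
    simp [max_eq_right hy.out.le]

/-- A `C¹` bump supported in `closedBall x s`. -/
def radialBump {m : ℕ} (x : Em m) (s : ℝ) (y : Em m) : ℝ :=
  max 0 (s ^ 2 - ‖y - x‖ ^ 2) ^ 2

theorem hasFDerivAt_radialBump {m : ℕ} (x : Em m) (s : ℝ) (y : Em m) :
    HasFDerivAt (radialBump x s)
      ((-4 * max 0 (s ^ 2 - ‖y - x‖ ^ 2)) • innerSL ℝ (y - x)) y := by
  have h1 : HasFDerivAt (fun y : Em m => s ^ 2 - ‖y - x‖ ^ 2) (-(2 • innerSL ℝ (y - x))) y := by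
    simpa using (((hasFDerivAt_id y).sub_const x).norm_sq).const_sub (s ^ 2)
  have := (hasDerivAt_sq_max_zero (s ^ 2 - ‖y - x‖ ^ 2)).comp_hasFDerivAt y h1
  refine this.congr_fderiv ?_
  ext w
  simp
  ring

theorem contDiff_radialBump {m : ℕ} (x : Em m) (s : ℝ) : ContDiff ℝ 1 (radialBump x s) := by
  rw [contDiff_one_iff_hasFDerivAt]
  refine ⟨_, ?_, hasFDerivAt_radialBump x s⟩
  fun_prop

theorem radialBump_eq_zero {m : ℕ} {x y : Em m} {s : ℝ} (hs : 0 ≤ s) (hy : y ∉ closedBall x s) :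
    radialBump x s y = 0 := by
  rw [mem_closedBall, not_le, dist_eq_norm] at hy
  have : s ^ 2 - ‖y - x‖ ^ 2 ≤ 0 := by nlinarith
  simp [radialBump, max_eq_left this]

theorem tsupport_radialBump_subset {m : ℕ} (x : Em m) {s : ℝ} (hs : 0 ≤ s) :
    tsupport (radialBump x s) ⊆ closedBall x s :=
  closure_minimal (fun _ hy => by_contra fun h => hy (radialBump_eq_zero hs h)) isClosed_closedBall

theorem add_smul_mem_closedBall {m : ℕ} (x : Em m) {z : Em m} {s S : ℝ}
    (hz : z ∈ closedBall (0 : Em m) 1) (hs : 0 ≤ s) (hsS : s ≤ S) :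
    x + s • z ∈ closedBall x S := by
  rw [mem_closedBall_zero_iff] at hz
  rw [mem_closedBall, dist_self_add_left, norm_smul, Real.norm_of_nonneg hs]
  nlinarith

theorem SquashStationary.setIntegral_radial_eq_zero {m : ℕ} {U : Set (Em m)} (hU : IsOpen U)
    {f : Em m → ell2} {f' : Em m → (Em m →L[ℝ] ell2)}
    (hf : ∀ x ∈ U, HasFDerivAt f (f' x) x) (hf' : ContinuousOn f' U)
    (hE : IntegrableOn (fun x => hsNormSq (f' x)) U volume) (hst : SquashStationary U f)
    (v : ell2) {x : Em m} {s : ℝ} (hs : 0 < s) (hsU : closedBall x s ⊆ U) :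
    ∫ z in closedBall (0 : Em m) 1, (1 - ‖z‖ ^ 2) * ⟪f' (x + s • z) z, v⟫ = 0 := by
  have hsupp := tsupport_radialBump_subset x hs.le
  have h := hst.integral_hsInner_eq_zero hU hf hf' hE (contDiff_radialBump x s)
    ((isCompact_closedBall x s).of_isClosed_subset (isClosed_tsupport _) hsupp)
    (hsupp.trans hsU) v
  set g : Em m → ℝ := fun y => max 0 (s ^ 2 - ‖y - x‖ ^ 2) * ⟪f' y (y - x), v⟫ with hg
  have hgU : ∫ y in U, g y = 0 := by
    have : ∀ y, hsInner (f' y) ((fderiv ℝ (radialBump x s) y).smulRight v) = -4 * g y := by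
      intro y
      have e : ((-4 * max 0 (s ^ 2 - ‖y - x‖ ^ 2)) • innerSL ℝ (y - x)).smulRight v =
          (-4 * max 0 (s ^ 2 - ‖y - x‖ ^ 2)) • ((innerSL ℝ (y - x)).smulRight v) := by
        ext1 w
        simp [mul_smul]
      rw [(hasFDerivAt_radialBump x s y).fderiv, e, hsInner_smul_right, hsInner_smulRight_innerSL,
        hg, mul_assoc]
    simp only [this, integral_const_mul] at h
    linarith
  have hg0 : ∫ y, g y = 0 := by
    rw [← hgU]
    refine (setIntegral_eq_integral_of_forall_compl_eq_zero fun y hy => ?_).symm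
    have hy' : y ∉ closedBall x s := fun h => hy (hsU h)
    rw [mem_closedBall, not_le, dist_eq_norm] at hy'
    have : s ^ 2 - ‖y - x‖ ^ 2 ≤ 0 := by nlinarith
    simp [hg, max_eq_left this]
  have hgs : ∫ z, g (x + s • z) = 0 := by
    rw [Measure.integral_comp_smul volume (fun w => g (x + w)) s,
      integral_add_left_eq_self g x, hg0, smul_zero]
  have hz : ∀ z, g (x + s • z) =
      s ^ 3 * (max 0 (1 - ‖z‖ ^ 2) * ⟪f' (x + s • z) z, v⟫) := by
    intro z
    have : s ^ 2 - ‖s • z‖ ^ 2 = s ^ 2 * (1 - ‖z‖ ^ 2) := by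
      rw [norm_smul, mul_pow, Real.norm_eq_abs, sq_abs]; ring
    have h2 : max 0 (s ^ 2 * (1 - ‖z‖ ^ 2)) = s ^ 2 * max 0 (1 - ‖z‖ ^ 2) := by
      rw [mul_max_of_nonneg _ _ (sq_nonneg s), mul_zero]
    simp only [hg, add_sub_cancel_left, this, h2, map_smul, real_inner_smul_left]
    ring
  simp only [hz, integral_const_mul, mul_eq_zero, pow_eq_zero_iff three_ne_zero, hs.ne',
    false_or] at hgs
  refine Eq.trans ?_ ((setIntegral_eq_integral_of_forall_compl_eq_zero
    (s := closedBall (0 : Em m) 1) ?_).trans hgs)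
  · refine setIntegral_congr_fun measurableSet_closedBall fun z hz => ?_
    rw [mem_closedBall_zero_iff] at hz
    have : 0 ≤ 1 - ‖z‖ ^ 2 := by nlinarith [norm_nonneg z]
    simp only [max_eq_right this]
  · intro z hz
    rw [mem_closedBall_zero_iff, not_le] at hz
    have : 1 - ‖z‖ ^ 2 ≤ 0 := by nlinarith
    simp [max_eq_left this]

/-- Mean value property with the radial weight `1 - ‖z‖²`. -/
theorem SquashStationary.setIntegral_weight_mul_inner {m : ℕ} {U : Set (Em m)} (hU : IsOpen U)
    {f : Em m → ell2} {f' : Em m → (Em m →L[ℝ] ell2)}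
    (hf : ∀ x ∈ U, HasFDerivAt f (f' x) x) (hf' : ContinuousOn f' U)
    (hE : IntegrableOn (fun x => hsNormSq (f' x)) U volume) (hst : SquashStationary U f)
    (v : ell2) {x : Em m} {S : ℝ} (hS : 0 < S) (hSU : closedBall x S ⊆ U) :
    ∫ z in closedBall (0 : Em m) 1, (1 - ‖z‖ ^ 2) * ⟪f (x + S • z), v⟫ =
      (∫ z in closedBall (0 : Em m) 1, (1 - ‖z‖ ^ 2)) * ⟪f x, v⟫ := by
  have hfc : ContinuousOn f U := fun y hy => (hf y hy).continuousAt.continuousWithinAt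
  have hmem : ∀ z ∈ closedBall (0 : Em m) 1, ∀ s ∈ Set.Icc 0 S, x + s • z ∈ U :=
    fun z hz s hs => hSU (add_smul_mem_closedBall x hz hs.1 hs.2)
  have hcont : ContinuousOn
      (fun p : Em m × ℝ => (1 - ‖p.1‖ ^ 2) * ⟪f' (x + p.2 • p.1) p.1, v⟫)
      (closedBall (0 : Em m) 1 ×ˢ Set.Icc 0 S) := by
    have h1 : ContinuousOn (fun p : Em m × ℝ => f' (x + p.2 • p.1))
        (closedBall (0 : Em m) 1 ×ˢ Set.Icc 0 S) :=
      hf'.comp (by fun_prop) fun p hp => hmem p.1 hp.1 p.2 hp.2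
    exact (by fun_prop : Continuous fun p : Em m × ℝ => 1 - ‖p.1‖ ^ 2).continuousOn.mul
      ((h1.clm_apply continuousOn_fst).inner continuousOn_const)
  have hftc : ∀ z ∈ closedBall (0 : Em m) 1,
      ∫ s in Set.Icc 0 S, (1 - ‖z‖ ^ 2) * ⟪f' (x + s • z) z, v⟫ =
        (1 - ‖z‖ ^ 2) * ⟪f (x + S • z), v⟫ - (1 - ‖z‖ ^ 2) * ⟪f x, v⟫ := by
    intro z hz
    rw [integral_Icc_eq_integral_Ioc, ← intervalIntegral.integral_of_le hS.le]
    have hd : ∀ s ∈ Set.uIcc 0 S, HasDerivAt (fun s : ℝ => (1 - ‖z‖ ^ 2) * ⟪f (x + s • z), v⟫)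
        ((1 - ‖z‖ ^ 2) * ⟪f' (x + s • z) z, v⟫) s := by
      intro s hs
      rw [Set.uIcc_of_le hS.le] at hs
      have hl : HasDerivAt (fun s : ℝ => x + s • z) z s := by
        simpa using ((hasDerivAt_id s).smul_const z).const_add x
      have hc := (hf _ (hmem z hz s hs)).comp_hasDerivAt s hl
      simpa using (hc.inner ℝ (hasDerivAt_const s v)).const_mul (1 - ‖z‖ ^ 2)
    rw [intervalIntegral.integral_eq_sub_of_hasDerivAt hd]
    · simp
    · refine ContinuousOn.intervalIntegrable ?_
      rw [Set.uIcc_of_le hS.le]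
      exact hcont.comp (f := fun s : ℝ => (z, s)) (by fun_prop) fun s hs => ⟨hz, hs⟩
  have hint : Integrable (Function.uncurry fun (z : Em m) (s : ℝ) =>
      (1 - ‖z‖ ^ 2) * ⟪f' (x + s • z) z, v⟫)
      ((volume.restrict (closedBall (0 : Em m) 1)).prod (volume.restrict (Set.Icc 0 S))) := by
    rw [Measure.prod_restrict]
    exact hcont.integrableOn_compact ((isCompact_closedBall _ _).prod isCompact_Icc)
  have hswap := integral_integral_swap hint
  rw [setIntegral_congr_fun measurableSet_closedBall hftc] at hswap
  have hzero : ∫ s in Set.Icc 0 S, ∫ z in closedBall (0 : Em m) 1,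
      (1 - ‖z‖ ^ 2) * ⟪f' (x + s • z) z, v⟫ = 0 := by
    rw [integral_Icc_eq_integral_Ioc]
    refine setIntegral_eq_zero_of_forall_eq_zero fun s hs => ?_
    exact hst.setIntegral_radial_eq_zero hU hf hf' hE v hs.1
      ((closedBall_subset_closedBall hs.2).trans hSU)
  rw [hzero, integral_sub, sub_eq_zero] at hswap
  · rw [hswap, integral_mul_const]
  · refine ContinuousOn.integrableOn_compact (isCompact_closedBall _ _) ?_
    have h1 : ContinuousOn (fun z : Em m => f (x + S • z)) (closedBall (0 : Em m) 1) :=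
      hfc.comp (by fun_prop) fun z hz => hmem z hz S ⟨hS.le, le_rfl⟩
    exact (by fun_prop : Continuous fun z : Em m => 1 - ‖z‖ ^ 2).continuousOn.mul
      (h1.inner continuousOn_const)
  · exact ContinuousOn.integrableOn_compact (isCompact_closedBall _ _) (by fun_prop)

theorem setIntegral_weight_pos (m : ℕ) :
    0 < ∫ z in closedBall (0 : Em m) 1, (1 - ‖z‖ ^ 2) := by
  have hnn : ∀ z ∈ closedBall (0 : Em m) 1, 0 ≤ 1 - ‖z‖ ^ 2 := fun z hz => by
    rw [mem_closedBall_zero_iff] at hz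
    nlinarith [norm_nonneg z]
  have hc : Continuous fun z : Em m => 1 - ‖z‖ ^ 2 := by fun_prop
  rw [setIntegral_pos_iff_support_of_nonneg_ae
    ((ae_restrict_mem measurableSet_closedBall).mono hnn)
    (hc.continuousOn.integrableOn_compact (isCompact_closedBall _ _))]
  refine (measure_ball_pos volume (0 : Em m) one_pos).trans_le (measure_mono fun z hz => ?_)
  refine ⟨?_, ball_subset_closedBall hz⟩
  rw [mem_ball_zero_iff] at hz
  have : 0 < 1 - ‖z‖ ^ 2 := by nlinarith [norm_nonneg z]
  exact this.ne'

/-- One-dimensional Poincaré type bound along a segment. -/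
theorem sq_norm_sub_le_integral {F : Type*} [NormedAddCommGroup F] [NormedSpace ℝ F]
    [CompleteSpace F] {γ γ' : ℝ → F}
    (hd : ∀ s ∈ Set.Icc (1 / 2 : ℝ) 1, HasDerivAt γ (γ' s) s)
    (hc : ContinuousOn γ' (Set.Icc (1 / 2 : ℝ) 1)) :
    ‖γ 1 - γ (1 / 2)‖ ^ 2 ≤ ∫ s in Set.Icc (1 / 2 : ℝ) 1, ‖γ' s‖ ^ 2 := by
  have h2 : (1 / 2 : ℝ) ≤ 1 := by norm_num
  set N := ‖γ 1 - γ (1 / 2)‖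
  have hN : N ≤ ∫ s in Set.Icc (1 / 2 : ℝ) 1, ‖γ' s‖ := by
    have := intervalIntegral.integral_eq_sub_of_hasDerivAt (a := 1 / 2) (b := 1)
      (by rwa [Set.uIcc_of_le h2]) (ContinuousOn.intervalIntegrable (by rwa [Set.uIcc_of_le h2]))
    rw [intervalIntegral.integral_of_le h2, ← integral_Icc_eq_integral_Ioc] at this
    rw [show N = ‖γ 1 - γ (1 / 2)‖ from rfl, ← this]
    exact norm_integral_le_integral_norm _
  have hi1 : IntegrableOn (fun s => ‖γ' s‖) (Set.Icc (1 / 2 : ℝ) 1) :=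
    hc.norm.integrableOn_compact isCompact_Icc
  have hi2 : IntegrableOn (fun s => ‖γ' s‖ ^ 2) (Set.Icc (1 / 2 : ℝ) 1) :=
    (hc.norm.pow 2).integrableOn_compact isCompact_Icc
  have hic : IntegrableOn (fun _ : ℝ => N ^ 2) (Set.Icc (1 / 2 : ℝ) 1) :=
    continuousOn_const.integrableOn_compact isCompact_Icc
  have hle : ∫ s in Set.Icc (1 / 2 : ℝ) 1, (2 * N * ‖γ' s‖ - N ^ 2) ≤
      ∫ s in Set.Icc (1 / 2 : ℝ) 1, ‖γ' s‖ ^ 2 :=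
    integral_mono ((hi1.const_mul _).sub hic) hi2 fun s => by
      nlinarith [sq_nonneg (‖γ' s‖ - N)]
  rw [integral_sub (hi1.const_mul _) hic, integral_const_mul, setIntegral_const] at hle
  have hv : volume.real (Set.Icc (1 / 2 : ℝ) 1) = 1 / 2 := by
    rw [Real.volume_real_Icc_of_le h2]; norm_num
  rw [hv, smul_eq_mul] at hle
  nlinarith [norm_nonneg (γ 1 - γ (1 / 2)), sq_nonneg N]

/-- Averages of an integrable function over dilations with ratio in `[1/2, 1]` are integrable. -/
theorem integrable_integral_dilation {m : ℕ} {G : Em m → ℝ} (hm : Measurable G)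
    (hG : Integrable G) (a : Em m) :
    Integrable fun y => ∫ s in Set.Icc (1 / 2 : ℝ) 1, G (a + s • (y - a)) := by
  have hpos : ∀ s ∈ Set.Icc (1 / 2 : ℝ) 1, 0 < s := fun s hs => by
    have := hs.1
    linarith
  have hmeas : Measurable fun p : Em m × ℝ => G (a + p.2 • (p.1 - a)) :=
    hm.comp (by fun_prop : Continuous fun p : Em m × ℝ => a + p.2 • (p.1 - a)).measurable
  refine Integrable.integral_prod_left (f := fun p : Em m × ℝ => G (a + p.2 • (p.1 - a))) ?_
  rw [integrable_prod_iff' hmeas.aestronglyMeasurable]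
  constructor
  · filter_upwards [ae_restrict_mem measurableSet_Icc] with s hs
    exact ((hG.comp_add_left a).comp_smul (hpos s hs).ne').comp_sub_right a
  · have : ∀ s ∈ Set.Icc (1 / 2 : ℝ) 1,
        (s ^ m)⁻¹ * ∫ y, ‖G y‖ = ∫ y, ‖G (a + s • (y - a))‖ := fun s hs => by
      rw [integral_sub_right_eq_self (fun y => ‖G (a + s • y)‖) a,
        Measure.integral_comp_smul_of_nonneg volume (fun y => ‖G (a + y)‖) s
          (hR := (hpos s hs).le),
        integral_add_left_eq_self (fun y => ‖G y‖) a, finrank_euclideanSpace_fin, smul_eq_mul]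
    refine IntegrableOn.congr_fun ?_ this measurableSet_Icc
    refine ContinuousOn.integrableOn_compact isCompact_Icc ?_
    exact ((continuousOn_id.pow m).inv₀ fun s hs => pow_ne_zero _ (hpos s hs).ne').mul
      continuousOn_const

/-- A `C¹` map with finite Dirichlet energy on a ball is square integrable there. -/
theorem integrableOn_sq_norm_of_integrableOn_hsNormSq {m : ℕ} {f : Em m → ell2}
    {f' : Em m → (Em m →L[ℝ] ell2)} {a : Em m} {R : ℝ} (hR : 0 < R)
    (hf : ∀ x ∈ ball a R, HasFDerivAt f (f' x) x) (hf' : ContinuousOn f' (ball a R))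
    (hE : IntegrableOn (fun x => hsNormSq (f' x)) (ball a R)) :
    IntegrableOn (fun y => ‖f y‖ ^ 2) (ball a R) := by
  classical
  have hfc : ContinuousOn f (ball a R) := fun y hy => (hf y hy).continuousAt.continuousWithinAt
  set G : Em m → ℝ := (ball a R).indicator fun x => hsNormSq (f' x) with hGdef
  have hGm : Measurable G := by
    rw [hGdef, ← Set.piecewise_eq_indicator]
    exact (continuous_hsNormSq.comp_continuousOn hf').measurable_piecewise
      continuousOn_const measurableSet_ball
  have hGi : Integrable G := hE.integrable_indicator measurableSet_ball
  have hmem : ∀ y ∈ ball a R, ∀ s ∈ Set.Icc (0 : ℝ) 1, a + s • (y - a) ∈ closedBall a (s * R) := by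
    intro y hy s hs
    rw [mem_ball, dist_eq_norm] at hy
    rw [mem_closedBall, dist_self_add_left, norm_smul, Real.norm_of_nonneg hs.1]
    exact mul_le_mul_of_nonneg_left hy.le hs.1
  have hmem' : ∀ y ∈ ball a R, ∀ s ∈ Set.Icc (1 / 2 : ℝ) 1, a + s • (y - a) ∈ ball a R := by
    intro y hy s hs
    have hs0 : 0 ≤ s := by linarith [hs.1]
    rw [mem_ball, dist_eq_norm] at hy ⊢
    rw [add_sub_cancel_left, norm_smul, Real.norm_of_nonneg hs0]
    nlinarith [hs.2, norm_nonneg (y - a)]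
  obtain ⟨M, hM⟩ := (isCompact_closedBall a (1 / 2 * R)).exists_bound_of_continuousOn
    (hfc.mono (closedBall_subset_ball (by linarith)))
  have hbound : ∀ y ∈ ball a R, ‖f y‖ ^ 2 ≤
      2 * (R ^ 2 * ∫ s in Set.Icc (1 / 2 : ℝ) 1, G (a + s • (y - a))) + 2 * M ^ 2 := by
    intro y hy
    have hseg := sq_norm_sub_le_integral (γ := fun s : ℝ => f (a + s • (y - a)))
      (γ' := fun s => f' (a + s • (y - a)) (y - a))
      (fun s hs => by
        have hl : HasDerivAt (fun s : ℝ => a + s • (y - a)) (y - a) s := by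
          simpa using ((hasDerivAt_id s).smul_const (y - a)).const_add a
        exact (hf _ (hmem' y hy s hs)).comp_hasDerivAt s hl)
      ((hf'.comp (by fun_prop) fun s hs => hmem' y hy s hs).clm_apply continuousOn_const)
    have hcG : ContinuousOn (fun s : ℝ => G (a + s • (y - a))) (Set.Icc (1 / 2 : ℝ) 1) := by
      have : ContinuousOn (fun s : ℝ => hsNormSq (f' (a + s • (y - a))))
          (Set.Icc (1 / 2 : ℝ) 1) :=
        continuous_hsNormSq.comp_continuousOn
          (hf'.comp (by fun_prop) fun s hs => hmem' y hy s hs)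
      refine this.congr fun s hs => ?_
      simp only [hGdef, Set.indicator_of_mem (hmem' y hy s hs)]
    have hle : ∫ s in Set.Icc (1 / 2 : ℝ) 1, ‖f' (a + s • (y - a)) (y - a)‖ ^ 2 ≤
        R ^ 2 * ∫ s in Set.Icc (1 / 2 : ℝ) 1, G (a + s • (y - a)) := by
      rw [← integral_const_mul]
      refine setIntegral_mono_on ?_ ((hcG.integrableOn_compact isCompact_Icc).const_mul _)
        measurableSet_Icc fun s hs => ?_
      · exact ((((hf'.comp (by fun_prop) fun s hs => hmem' y hy s hs).clm_apply
          continuousOn_const).norm).pow 2).integrableOn_compact isCompact_Icc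
      · rw [hGdef, Set.indicator_of_mem (hmem' y hy s hs)]
        refine (sq_norm_apply_le _ _).trans
          (mul_le_mul_of_nonneg_right ?_ (hsNormSq_nonneg _))
        rw [mem_ball, dist_eq_norm] at hy
        exact pow_le_pow_left₀ (norm_nonneg _) hy.le 2
    have hhalf := hM _ (hmem y hy (1 / 2) ⟨by norm_num, by norm_num⟩)
    simp only [one_smul, add_sub_cancel] at hseg
    have htri : ‖f y‖ ≤ ‖f y - f (a + (1 / 2 : ℝ) • (y - a))‖ + M := by
      have := norm_add_le (f y - f (a + (1 / 2 : ℝ) • (y - a))) (f (a + (1 / 2 : ℝ) • (y - a)))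
      rw [sub_add_cancel] at this
      linarith
    have hsq := pow_le_pow_left₀ (norm_nonneg _) htri 2
    have hseg' := hseg.trans hle
    nlinarith [sq_nonneg (‖f y - f (a + (1 / 2 : ℝ) • (y - a))‖ - M)]
  refine Integrable.mono' (g := fun y =>
      2 * (R ^ 2 * ∫ s in Set.Icc (1 / 2 : ℝ) 1, G (a + s • (y - a))) + 2 * M ^ 2)
    ?_ ((hfc.norm.pow 2).aestronglyMeasurable measurableSet_ball) ?_
  · refine Integrable.add ?_ (integrableOn_const measure_ball_lt_top.ne)
    exact (((integrable_integral_dilation hGm hGi a).const_mul _).const_mul _).integrableOn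
  · filter_upwards [ae_restrict_mem measurableSet_ball] with y hy
    rw [Real.norm_of_nonneg (sq_nonneg _)]
    exact hbound y hy

theorem setIntegral_closedBall_comp_add_smul {m : ℕ} (g : Em m → ℝ) (x : Em m) {r : ℝ}
    (hr : 0 < r) :
    ∫ z in closedBall (0 : Em m) 1, g (x + r • z) = (r ^ m)⁻¹ * ∫ y in closedBall x r, g y := by
  rw [← integral_indicator measurableSet_closedBall, ← integral_indicator measurableSet_closedBall]
  have h : ∀ z : Em m, (closedBall (0 : Em m) 1).indicator (fun z => g (x + r • z)) z =
      (closedBall x r).indicator g (x + r • z) := by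
    intro z
    have : x + r • z ∈ closedBall x r ↔ z ∈ closedBall (0 : Em m) 1 := by
      rw [mem_closedBall, dist_self_add_left, norm_smul, Real.norm_of_nonneg hr.le,
        mem_closedBall_zero_iff]
      constructor <;> intro h <;> nlinarith
    by_cases hz : z ∈ closedBall (0 : Em m) 1
    · rw [Set.indicator_of_mem hz, Set.indicator_of_mem (this.2 hz)]
    · rw [Set.indicator_of_notMem hz, Set.indicator_of_notMem (mt this.1 hz)]
  simp only [h]
  rw [Measure.integral_comp_smul_of_nonneg volume
    (fun w => (closedBall x r).indicator g (x + w)) r (hR := hr.le),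
    integral_add_left_eq_self ((closedBall x r).indicator g) x, finrank_euclideanSpace_fin,
    smul_eq_mul]

/-- Local boundedness of squeeze and squash stationary maps: there is
`C > 0` depending only on `m` such that whenever `B(a,3r₀) ⊆ U`,
`sup_{B(a,r₀)} ‖f‖² ≤ (C/r₀^m)·∫_{B(a,3r₀)} ‖f‖²`. -/
theorem stmt15 (m : ℕ) (hm : 2 ≤ m) :
    ∃ C : ℝ, 0 < C ∧
      ∀ (U : Set (Em m)), IsOpen U →
      ∀ (f : Em m → ell2) (f' : Em m → (Em m →L[ℝ] ell2)),
        (∀ x ∈ U, HasFDerivAt f (f' x) x) → ContinuousOn f' U →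
        IntegrableOn (fun x => hsNormSq (f' x)) U volume →
        SqueezeStationary U f → SquashStationary U f →
        ∀ (a : Em m) (r₀ : ℝ), 0 < r₀ → Metric.ball a (3 * r₀) ⊆ U →
        ∀ x ∈ Metric.ball a r₀,
          ‖f x‖ ^ 2 ≤ C / r₀ ^ m * ∫ y in Metric.ball a (3 * r₀), ‖f y‖ ^ 2 := by
  have hc := setIntegral_weight_pos m
  set c := ∫ z in closedBall (0 : Em m) 1, (1 - ‖z‖ ^ 2) with hcdef
  refine ⟨c⁻¹, inv_pos.2 hc, ?_⟩
  intro U hU f f' hf hf' hE _ hst a r hr hball x hx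
  have hfc : ContinuousOn f U := fun y hy => (hf y hy).continuousAt.continuousWithinAt
  have hsub : closedBall x r ⊆ ball a (3 * r) := by
    refine closedBall_subset_ball' ?_
    rw [mem_ball] at hx
    linarith
  have hL2 : IntegrableOn (fun y => ‖f y‖ ^ 2) (ball a (3 * r)) :=
    integrableOn_sq_norm_of_integrableOn_hsNormSq (by linarith) (fun y hy => hf y (hball hy))
      (hf'.mono hball) (hE.mono_set hball)
  have hmean := hst.setIntegral_weight_mul_inner hU hf hf' hE (f x) hr (hsub.trans hball)
  have hfz : ContinuousOn (fun z : Em m => f (x + r • z)) (closedBall (0 : Em m) 1) :=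
    hfc.comp (by fun_prop) fun z hz =>
      hball (hsub (add_smul_mem_closedBall x hz hr.le le_rfl))
  have hw : ContinuousOn (fun z : Em m => 1 - ‖z‖ ^ 2) (closedBall (0 : Em m) 1) := by fun_prop
  have hi1 : IntegrableOn (fun z : Em m => (1 - ‖z‖ ^ 2) * ⟪f (x + r • z), f x⟫)
      (closedBall (0 : Em m) 1) :=
    (hw.mul (hfz.inner continuousOn_const)).integrableOn_compact (isCompact_closedBall _ _)
  have hi2 : IntegrableOn (fun z : Em m => 1 / 2 * ‖f (x + r • z)‖ ^ 2)
      (closedBall (0 : Em m) 1) :=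
    (continuousOn_const.mul (hfz.norm.pow 2)).integrableOn_compact (isCompact_closedBall _ _)
  have hi3 : IntegrableOn (fun z : Em m => (1 - ‖z‖ ^ 2) * (1 / 2 * ‖f x‖ ^ 2))
      (closedBall (0 : Em m) 1) :=
    (hw.mul continuousOn_const).integrableOn_compact (isCompact_closedBall _ _)
  have hle : ∫ z in closedBall (0 : Em m) 1, (1 - ‖z‖ ^ 2) * ⟪f (x + r • z), f x⟫ ≤
      ∫ z in closedBall (0 : Em m) 1,
        (1 / 2 * ‖f (x + r • z)‖ ^ 2 + (1 - ‖z‖ ^ 2) * (1 / 2 * ‖f x‖ ^ 2)) := by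
    refine setIntegral_mono_on hi1 (hi2.add hi3) measurableSet_closedBall fun z hz => ?_
    rw [mem_closedBall_zero_iff] at hz
    have h0 : 0 ≤ 1 - ‖z‖ ^ 2 := by nlinarith [norm_nonneg z]
    have hin := real_inner_le_norm (f (x + r • z)) (f x)
    have hin' : ⟪f (x + r • z), f x⟫ ≤ 1 / 2 * ‖f (x + r • z)‖ ^ 2 + 1 / 2 * ‖f x‖ ^ 2 := by
      nlinarith [sq_nonneg (‖f (x + r • z)‖ - ‖f x‖)]
    nlinarith [mul_le_mul_of_nonneg_left hin' h0,
      mul_nonneg (sq_nonneg ‖z‖) (sq_nonneg ‖f (x + r • z)‖)]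
  rw [hmean, integral_add hi2 hi3, integral_const_mul, integral_mul_const, ← hcdef,
    setIntegral_closedBall_comp_add_smul (fun y => ‖f y‖ ^ 2) x hr,
    real_inner_self_eq_norm_sq] at hle
  have hmono : ∫ y in closedBall x r, ‖f y‖ ^ 2 ≤ ∫ y in ball a (3 * r), ‖f y‖ ^ 2 :=
    setIntegral_mono_set hL2 (Filter.Eventually.of_forall fun y => sq_nonneg _)
      hsub.eventuallyLE
  have hrm : 0 ≤ (r ^ m)⁻¹ := by positivity
  have hmain : c * ‖f x‖ ^ 2 ≤ (r ^ m)⁻¹ * ∫ y in ball a (3 * r), ‖f y‖ ^ 2 := by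
    linarith [mul_le_mul_of_nonneg_left hmono hrm]
  rw [div_eq_mul_inv, mul_assoc, ← div_eq_inv_mul, le_div_iff₀ hc, mul_comm]
  exact hmain
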